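/- Let G be a strongly regular graph with parameters (1911, 270, 105, 27) containing an induced quadrangle x ~ u ~ y ~ v ~ x, and let W = {w : w ~ x, w ∉ {u, v}, w not adjacent to u, w not adjacent to v}. Then |W| ≠ 82. -/

import Mathlib

open Finset

namespace SimpleGraph
section adjCount

variable {V : Type*}

/-- The number of ordered pairs of adjacent vertices in `X ×ˢ Y`. -/
def adjCount (H : SimpleGraph V) [DecidableRel H.Adj] (X Y : Finset V) : ℤ :=
  ∑ a ∈ X, (#{b ∈ Y | H.Adj a b} : ℤ)

variable {H : SimpleGraph V} [DecidableRel H.Adj]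

lemma adjCount_comm (X Y : Finset V) : H.adjCount X Y = H.adjCount Y X := by
  simp only [adjCount, card_filter, Nat.cast_sum]
  rw [sum_comm]
  simp only [H.adj_comm]

lemma adjCount_union_right [DecidableEq V] {X Y Z : Finset V} (hYZ : Disjoint Y Z) :
    H.adjCount X (Y ∪ Z) = H.adjCount X Y + H.adjCount X Z := by
  simp only [adjCount, ← sum_add_distrib]
  refine sum_congr rfl fun a _ => ?_
  rw [filter_union, card_union_of_disjoint (disjoint_filter_filter hYZ)]
  simp

lemma adjCount_eq_zero {X Y : Finset V} (hXY : ∀ a ∈ X, ∀ b ∈ Y, ¬ H.Adj a b) :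
    H.adjCount X Y = 0 := by
  refine sum_eq_zero fun a ha => ?_
  rw [filter_false_of_mem (hXY a ha)]
  simp

/-- Mantel's theorem for the subgraph induced on a finite set. -/
lemma two_mul_adjCount_self_le [DecidableEq V] {J : Finset V}
    (htri : ∀ a ∈ J, ∀ b ∈ J, ∀ c ∈ J, H.Adj a b → H.Adj b c → ¬ H.Adj a c) :
    2 * H.adjCount J J ≤ (#J : ℤ) ^ 2 := by
  let d : V → ℤ := fun a => #{b ∈ J | H.Adj a b}
  have hsq : ∑ a ∈ J, ∑ b ∈ J with H.Adj a b, (d a + d b) = 2 * ∑ a ∈ J, d a ^ 2 := by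
    have h1 : ∑ a ∈ J, ∑ b ∈ J with H.Adj a b, d a = ∑ a ∈ J, d a ^ 2 := by
      refine sum_congr rfl fun a _ => ?_
      rw [sum_const, nsmul_eq_mul, sq]
    have h2 : ∑ a ∈ J, ∑ b ∈ J with H.Adj a b, d b = ∑ a ∈ J, d a ^ 2 := by
      rw [← h1]
      simp only [sum_filter]
      rw [sum_comm]
      simp only [H.adj_comm]
    simp only [sum_add_distrib, h1, h2]
    ring
  have hle : ∑ a ∈ J, ∑ b ∈ J with H.Adj a b, (d a + d b) ≤ ∑ a ∈ J, d a * #J := by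
    refine sum_le_sum fun a ha => ?_
    rw [← nsmul_eq_mul]
    refine sum_le_card_nsmul _ _ _ fun b hb => ?_
    simp only [mem_filter] at hb
    have hdis : Disjoint {c ∈ J | H.Adj a c} {c ∈ J | H.Adj b c} := by
      rw [Finset.disjoint_left]
      intro c hc hc'
      simp only [mem_filter] at hc hc'
      exact htri a ha b hb.1 c hc.1 hb.2 hc'.2 hc.2
    have := card_le_card
      (union_subset (filter_subset (fun c => H.Adj a c) J) (filter_subset (fun c => H.Adj b c) J))
    rw [card_union_of_disjoint hdis] at this
    simp only [d]
    exact_mod_cast this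
  rw [hsq, ← sum_mul] at hle
  have hcs := sq_sum_le_card_mul_sum_sq (s := J) (f := d)
  have hE : H.adjCount J J = ∑ a ∈ J, d a := rfl
  rw [hE]
  rcases (sum_nonneg fun a _ => by positivity : 0 ≤ ∑ a ∈ J, d a).eq_or_lt with h0 | h0
  · rw [← h0]; positivity
  · have hJ : (0 : ℤ) ≤ #J := by positivity
    refine le_of_mul_le_mul_right ?_ h0
    nlinarith

/-- There is no triangle-free graph on 82 vertices whose vertices are isolated or of degree 28,
with independence number at most 31, and in which every vertex outside an independent set of
size 28 has at most 6 or at least 21 neighbours in it. -/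
lemma false_of_triangle_free_of_card [DecidableEq V] {W : Finset V} (hW : #W = 82)
    (htri : ∀ a ∈ W, ∀ b ∈ W, ∀ c ∈ W, H.Adj a b → H.Adj b c → ¬ H.Adj a c)
    (hdeg : ∀ a ∈ W, ∀ b ∈ W, H.Adj a b → #{z ∈ W | H.Adj a z} = 28)
    (hind : ∀ I ⊆ W, (∀ a ∈ I, ∀ b ∈ I, ¬ H.Adj a b) → #I ≤ 31)
    (hcodeg : ∀ I ⊆ W, (∀ a ∈ I, ∀ b ∈ I, ¬ H.Adj a b) → #I = 28 → ∀ a ∈ W, a ∉ I →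
      #{b ∈ I | H.Adj a b} ≤ 6 ∨ 21 ≤ #{b ∈ I | H.Adj a b}) : False := by
  obtain ⟨p, hp, q, hq, hpq⟩ : ∃ p ∈ W, ∃ q ∈ W, H.Adj p q := by
    by_contra! hno
    have := hind W subset_rfl hno
    omega
  set I : Finset V := {z ∈ W | H.Adj p z} with hI
  have hIW : I ⊆ W := filter_subset _ _
  have hI28 : #I = 28 := hdeg p hp q hq hpq
  have hIind : ∀ a ∈ I, ∀ b ∈ I, ¬ H.Adj a b := by
    intro a ha b hb hab
    simp only [hI, mem_filter] at ha hb
    exact htri p hp a ha.1 b hb.1 ha.2 hab hb.2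
  let k : V → ℕ := fun a => #{b ∈ I | H.Adj a b}
  set P : Finset V := {z ∈ W | ∃ b ∈ W, H.Adj z b} with hP
  set T : Finset V := {z ∈ W | ¬ ∃ b ∈ W, H.Adj z b} with hT
  set L : Finset V := {z ∈ P \ I | 21 ≤ k z} with hL
  set J : Finset V := {z ∈ P \ I | ¬ 21 ≤ k z} with hJ
  have hIP : I ⊆ P := fun a ha => by
    simp only [hI, hP, mem_filter] at ha ⊢
    exact ⟨ha.1, p, hp, ha.2.symm⟩
  have hPT : #P + #T = 82 := by rw [← hW]; exact card_filter_add_card_filter_not _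
  have hLJ : #L + #J = #(P \ I) := card_filter_add_card_filter_not _
  have hPI : #(P \ I) + 28 = #P := by rw [← hI28]; exact card_sdiff_add_card_eq_card hIP
  have hPW : P ⊆ W := filter_subset _ _
  have hLPI : L ⊆ P \ I := filter_subset _ _
  have hJPI : J ⊆ P \ I := filter_subset _ _
  have hLW : L ⊆ W := (hLPI.trans sdiff_subset).trans hPW
  have hJW : J ⊆ W := (hJPI.trans sdiff_subset).trans hPW
  have hLind : ∀ a ∈ L, ∀ b ∈ L, ¬ H.Adj a b := by
    intro a ha b hb hab
    have hdis : Disjoint {c ∈ I | H.Adj a c} {c ∈ I | H.Adj b c} := by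
      rw [Finset.disjoint_left]
      intro c hc hc'
      simp only [mem_filter] at hc hc'
      exact htri a (hLW ha) b (hLW hb) c (hIW hc.1) hab hc'.2 hc.2
    have := card_le_card
      (union_subset (filter_subset (fun c => H.Adj a c) I) (filter_subset (fun c => H.Adj b c) I))
    rw [card_union_of_disjoint hdis, hI28] at this
    have hka : 21 ≤ k a := (mem_filter.1 ha).2
    have hkb : 21 ≤ k b := (mem_filter.1 hb).2
    simp only [k] at hka hkb
    omega
  have hTno : ∀ a ∈ T, ∀ b ∈ W, ¬ H.Adj a b := by
    intro a ha b hb hab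
    exact (mem_filter.1 ha).2 ⟨b, hb, hab⟩
  have hTW : T ⊆ W := filter_subset _ _
  have hLT : #L + #T ≤ 31 := by
    rw [← card_union_of_disjoint]
    · refine hind _ (union_subset hLW hTW) fun a ha b hb hab => ?_
      rcases mem_union.1 ha with ha | ha
      · rcases mem_union.1 hb with hb | hb
        · exact hLind a ha b hb hab
        · exact hTno b hb a (hLW ha) hab.symm
      · exact hTno a ha b (union_subset hLW hTW hb) hab
    · exact (disjoint_filter_filter_not W W _).mono_left (hLPI.trans sdiff_subset)
  have hpL : p ∈ L := by
    have hpI : p ∉ I := by simp [hI]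
    have hkp : k p = 28 := by
      simp only [k]
      rw [← hI28, filter_true_of_mem fun b hb => (mem_filter.1 hb).2]
    simp only [hL, hP, mem_filter, mem_sdiff]
    exact ⟨⟨⟨hp, q, hq, hpq⟩, hpI⟩, by omega⟩
  have hLpos : 0 < #L := card_pos.2 ⟨p, hpL⟩
  have hdegP : ∀ X ⊆ P, H.adjCount X I + H.adjCount X L + H.adjCount X J = 28 * #X := by
    intro X hX
    have hdecomp : T ∪ (I ∪ (L ∪ J)) = W := by
      rw [filter_union_filter_not_eq, union_sdiff_of_subset hIP, union_comm,
        filter_union_filter_not_eq]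
    have hTP : Disjoint T P := (disjoint_filter_filter_not W W _).symm
    have hLJd : Disjoint L J := disjoint_filter_filter_not _ _ _
    have hLJs : L ∪ J ⊆ P \ I := union_subset hLPI hJPI
    have hT0 : H.adjCount X T = 0 :=
      adjCount_eq_zero fun a ha b hb hab => hTno b hb a (hPW (hX ha)) hab.symm
    have hW28 : H.adjCount X W = 28 * #X := by
      rw [adjCount, sum_congr rfl (g := fun _ => (28 : ℤ)), sum_const, nsmul_eq_mul, mul_comm]
      intro a ha
      obtain ⟨haW, b, hb, hab⟩ := mem_filter.1 (hX ha)
      exact_mod_cast hdeg a haW b hb hab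
    rw [← hdecomp, adjCount_union_right, adjCount_union_right, adjCount_union_right hLJd, hT0]
      at hW28
    · linarith
    · exact disjoint_sdiff.mono_right hLJs
    · exact hTP.mono_right (union_subset hIP (hLJs.trans sdiff_subset))
  have eI := hdegP I hIP
  have eL := hdegP L (hLPI.trans sdiff_subset)
  have eJ := hdegP J (hJPI.trans sdiff_subset)
  rw [adjCount_eq_zero hIind] at eI
  rw [adjCount_eq_zero hLind, adjCount_comm L I] at eL
  rw [adjCount_comm J I, adjCount_comm J L] at eJ
  have hIJ : H.adjCount I J ≤ 6 * #J := by
    rw [adjCount_comm, adjCount, mul_comm, ← nsmul_eq_mul]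
    refine sum_le_card_nsmul _ _ _ fun a ha => ?_
    obtain ⟨haPI, hk⟩ := mem_filter.1 ha
    have := (hcodeg I hIW hIind hI28 a (hJW ha) (mem_sdiff.1 haPI).2).resolve_right hk
    exact_mod_cast this
  have hmantel : 2 * H.adjCount J J ≤ (#J : ℤ) ^ 2 :=
    two_mul_adjCount_self_le fun a ha b hb c hc => htri a (hJW ha) b (hJW hb) c (hJW hc)
  have hJlo : 23 ≤ #J := by omega
  have hJhi : #J ≤ 53 := by omega
  have hLJ54 : (#L : ℤ) + #J ≤ 54 := by omega
  rw [hI28] at eI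
  push_cast at eI
  have hJlo' : (23 : ℤ) ≤ #J := by exact_mod_cast hJlo
  have hJhi' : (#J : ℤ) ≤ 53 := by exact_mod_cast hJhi
  nlinarith

end adjCount

lemma IsSRGWith.card_common_of_not_adj {V : Type*} [Fintype V] {G : SimpleGraph V}
    [DecidableRel G.Adj] {n k ℓ μ : ℕ} (h : G.IsSRGWith n k ℓ μ) {a b : V} (hab : a ≠ b)
    (hadj : ¬ G.Adj a b) : #{z | G.Adj a z ∧ G.Adj b z} = μ := by
  rw [← h.of_not_adj hab hadj, ← Set.toFinset_card]
  congr 1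
  ext z
  simp [mem_commonNeighbors]

lemma IsSRGWith.card_common_of_adj {V : Type*} [Fintype V] {G : SimpleGraph V}
    [DecidableRel G.Adj] {n k ℓ μ : ℕ} (h : G.IsSRGWith n k ℓ μ) {a b : V}
    (hadj : G.Adj a b) : #{z | G.Adj a z ∧ G.Adj b z} = ℓ := by
  rw [← h.of_adj a b hadj, ← Set.toFinset_card]
  congr 1
  ext z
  simp [mem_commonNeighbors]

section SRG

open Matrix

variable {V : Type*} [Fintype V] [DecidableEq V] {G : SimpleGraph V} [DecidableRel G.Adj]

variable (G) in
/-- The matrix `A + 3I`, where `A` is the adjacency matrix. -/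
def shiftedAdj : Matrix V V ℤ := G.adjMatrix ℤ + 3 • (1 : Matrix V V ℤ)

lemma shiftedAdj_transpose : G.shiftedAdjᵀ = G.shiftedAdj := by
  simp [shiftedAdj]

lemma shiftedAdj_apply (a b : V) :
    G.shiftedAdj a b = (if G.Adj a b then 1 else 0) + 3 * (if a = b then 1 else 0) := by
  simp only [shiftedAdj, adjMatrix_apply, Matrix.one_apply, Matrix.add_apply, Matrix.smul_apply]
  simp

namespace IsSRGWith

lemma shiftedAdj_sq (h : G.IsSRGWith 1911 270 105 27) :
    G.shiftedAdj * G.shiftedAdj = 84 • G.shiftedAdj + 27 • Matrix.of fun _ _ => (1 : ℤ) := by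
  have h1 := h.matrix_eq (α := ℤ)
  have h2 : G.shiftedAdj * G.shiftedAdj =
      (G.adjMatrix ℤ) ^ 2 + 6 • G.adjMatrix ℤ + 9 • (1 : Matrix V V ℤ) := by
    unfold shiftedAdj
    noncomm_ring
  rw [h2, h1]
  ext a b
  simp only [shiftedAdj, adjMatrix_apply, Matrix.one_apply, Matrix.add_apply, Matrix.smul_apply,
    of_apply, compl_adj]
  by_cases hab : a = b
  · subst hab
    simp
  · by_cases hadj : G.Adj a b <;> simp [hab, hadj]

lemma sum_shiftedAdj_mulVec (h : G.IsSRGWith 1911 270 105 27) (f : V → ℤ) :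
    ∑ a, (G.shiftedAdj *ᵥ f) a = 273 * ∑ a, f a := by
  have h1 : ∀ b, ∑ a, G.shiftedAdj a b = 273 := by
    intro b
    simp only [shiftedAdj_apply, sum_add_distrib, ← mul_sum]
    have : ({a | G.Adj a b} : Finset V) = G.neighborFinset b := by
      ext a; simp [adj_comm]
    simp [this, h.regular.degree_eq]
  simp only [mulVec, dotProduct]
  rw [sum_comm, mul_sum]
  simp only [← sum_mul, h1]

lemma sum_shiftedAdj_mulVec_sq (h : G.IsSRGWith 1911 270 105 27) (f : V → ℤ) :
    ∑ a, (G.shiftedAdj *ᵥ f) a ^ 2 =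
      84 * (f ⬝ᵥ G.shiftedAdj *ᵥ f) + 27 * (∑ a, f a) ^ 2 := by
  have h1 : ∑ a, (G.shiftedAdj *ᵥ f) a ^ 2 = f ⬝ᵥ (G.shiftedAdj * G.shiftedAdj) *ᵥ f := by
    rw [← mulVec_mulVec, dotProduct_mulVec, ← mulVec_transpose, shiftedAdj_transpose]
    simp [dotProduct, sq]
  have h2 : f ⬝ᵥ (Matrix.of fun _ _ => (1 : ℤ)) *ᵥ f = (∑ a, f a) ^ 2 := by
    simp [dotProduct, mulVec, sq, sum_mul]
  rw [h1, h.shiftedAdj_sq, add_mulVec, dotProduct_add, smul_mulVec, smul_mulVec,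
    dotProduct_smul, dotProduct_smul, h2]
  simp

lemma shiftedAdj_form_nonneg (h : G.IsSRGWith 1911 270 105 27) (f : V → ℤ) :
    0 ≤ f ⬝ᵥ G.shiftedAdj *ᵥ f := by
  have h1 := h.sum_shiftedAdj_mulVec_sq f
  have h2 := sq_sum_le_card_mul_sum_sq (s := univ) (f := G.shiftedAdj *ᵥ f)
  rw [h.sum_shiftedAdj_mulVec, card_univ, h.card] at h2
  push_cast at h2
  nlinarith [sq_nonneg (∑ a, f a)]

end IsSRGWith

lemma IsClique.sum_shiftedAdj {K : Finset V} (hK : G.IsClique K) {a : V} (ha : a ∈ K) :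
    ∑ b ∈ K, G.shiftedAdj a b = #K + 2 := by
  have h1 : ∀ b ∈ K, G.shiftedAdj a b = 1 + 2 * (if a = b then 1 else 0) := by
    intro b hb
    rw [shiftedAdj_apply]
    by_cases hab : a = b
    · simp [hab]
    · simp [hab, hK ha hb hab]
  rw [sum_congr rfl h1, sum_add_distrib, ← mul_sum]
  simp [ha]

lemma sum_shiftedAdj_of_notMem {K : Finset V} {a : V} (ha : a ∉ K) :
    ∑ b ∈ K, G.shiftedAdj a b = #{b ∈ K | G.Adj a b} := by
  have h1 : ∀ b ∈ K, G.shiftedAdj a b = if G.Adj a b then 1 else 0 := by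
    intro b hb
    rw [shiftedAdj_apply, if_neg (c := a = b) (by rintro rfl; exact ha hb)]
    simp
  rw [sum_congr rfl h1]
  simp

/-- The indicator function of a finite set, in integers. -/
def ind (S : Finset V) : V → ℤ := fun a => if a ∈ S then 1 else 0

lemma shiftedAdj_mulVec_ind (S : Finset V) (a : V) :
    (G.shiftedAdj *ᵥ ind S) a = ∑ b ∈ S, G.shiftedAdj a b := by
  simp [mulVec, dotProduct, ind]

lemma ind_form (S T : Finset V) :
    ind S ⬝ᵥ G.shiftedAdj *ᵥ ind T = ∑ a ∈ S, ∑ b ∈ T, G.shiftedAdj a b := by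
  simp [dotProduct, shiftedAdj_mulVec_ind, ind]

namespace IsSRGWith

lemma clique_neighbors_bound (h : G.IsSRGWith 1911 270 105 27) {K : Finset V}
    (hK : G.IsClique K) {a : V} (ha : a ∉ K) {n : ℤ} (hn : #{b ∈ K | G.Adj a b} = n) :
    n * (#K + 2 - n) ≤ 6 * (#K + 2) := by
  set N : Finset V := {b ∈ K | G.Adj a b} with hN
  have hNK : N ⊆ K := filter_subset _ _
  have hNc : G.IsClique (N : Set V) := hK.subset (by exact_mod_cast hNK)
  have haN : a ∉ N := fun hh => ha (hNK hh)
  have sym : ∀ f g : V → ℤ, f ⬝ᵥ G.shiftedAdj *ᵥ g = g ⬝ᵥ G.shiftedAdj *ᵥ f := by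
    intro f g
    rw [dotProduct_mulVec, ← mulVec_transpose, shiftedAdj_transpose, dotProduct_comm]
  have haa : ind {a} ⬝ᵥ G.shiftedAdj *ᵥ ind {a} = 3 := by
    simp [ind_form, shiftedAdj_apply]
  have haK' : ind {a} ⬝ᵥ G.shiftedAdj *ᵥ ind K = n := by
    rw [ind_form, sum_singleton, sum_shiftedAdj_of_notMem ha, hn]
  have haN' : ind {a} ⬝ᵥ G.shiftedAdj *ᵥ ind N = n := by
    rw [ind_form, sum_singleton, sum_shiftedAdj_of_notMem haN, ← hn, hN, filter_filter]
    simp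
  have hNN : ind N ⬝ᵥ G.shiftedAdj *ᵥ ind N = n * (n + 2) := by
    rw [ind_form, sum_congr rfl fun b hb => hNc.sum_shiftedAdj hb]
    simp [hn]
  have hNK' : ind N ⬝ᵥ G.shiftedAdj *ᵥ ind K = n * (#K + 2) := by
    rw [ind_form, sum_congr rfl fun b hb => hK.sum_shiftedAdj (hNK hb)]
    simp [hn]
  have hKK : ind K ⬝ᵥ G.shiftedAdj *ᵥ ind K = #K * (#K + 2) := by
    rw [ind_form, sum_congr rfl fun b hb => hK.sum_shiftedAdj hb]
    simp
  have key := h.shiftedAdj_form_nonneg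
    ((2 * (#K + 2 : ℤ)) • ind {a} + (-(#K + 2 : ℤ)) • ind N + n • ind K)
  simp only [mulVec_add, dotProduct_add, add_dotProduct, mulVec_smul, dotProduct_smul,
    smul_dotProduct, smul_eq_mul, sym (ind N) (ind {a}), sym (ind K) (ind {a}),
    sym (ind K) (ind N), haa, haK', haN', hNN, hNK', hKK] at key
  have hM : (0 : ℤ) < #K + 2 := by positivity
  have key2 : 0 ≤ (#K + 2 : ℤ) * (6 * (#K + 2) - n * (#K + 2 - n)) := by linarith
  have := nonneg_of_mul_nonneg_right key2 hM
  linarith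

lemma clique_card_le (h : G.IsSRGWith 1911 270 105 27) {K₀ : Finset V}
    (hK₀ : G.IsClique K₀) : #K₀ ≤ 32 := by
  obtain ⟨K, hK, hKcard⟩ := G.exists_isNClique_cliqueNum
  have hle : #K₀ ≤ #K := hKcard ▸ hK₀.card_le_cliqueNum
  by_contra! hlt
  have hm : 33 ≤ #K := by omega
  let n : V → ℤ := fun a => #{b ∈ K | G.Adj a b}
  have hmax : ∀ a ∉ K, ∃ k ∈ K, ¬ G.Adj a k := by
    intro a ha
    by_contra! hall
    have : G.IsClique (insert a K : Finset V) := by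
      rw [coe_insert, isClique_insert]
      exact ⟨hK, fun b hb _ => hall b hb⟩
    have := this.card_le_cliqueNum
    rw [card_insert_of_notMem ha] at this
    omega
  have hn : ∀ a ∉ K, n a ≤ 7 := by
    intro a ha
    obtain ⟨k, hk, hak⟩ := hmax a ha
    have h27 : n a ≤ 27 := by
      have hne : a ≠ k := by rintro rfl; exact ha hk
      have h1 := h.card_common_of_not_adj hne hak
      have h2 : #{b ∈ K | G.Adj a b} ≤ #{z | G.Adj a z ∧ G.Adj k z} := by
        refine card_le_card fun b hb => ?_
        simp only [mem_filter, mem_univ, true_and] at hb ⊢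
        refine ⟨hb.2, hK hk hb.1 ?_⟩
        rintro rfl
        exact hak hb.2
      simp only [n]
      omega
    have h1 := h.clique_neighbors_bound hK ha (n := n a) rfl
    have hm' : (33 : ℤ) ≤ #K := by exact_mod_cast hm
    by_contra! h8
    have : (8 : ℤ) ≤ n a := h8
    nlinarith
  have hn0 : ∀ a, 0 ≤ n a := fun a => by positivity
  have hin : ∀ a ∈ K, (G.shiftedAdj *ᵥ ind K) a = #K + 2 := fun a ha => by
    rw [shiftedAdj_mulVec_ind, hK.sum_shiftedAdj ha]
  have hout : ∀ a ∈ Kᶜ, (G.shiftedAdj *ᵥ ind K) a = n a := fun a ha => by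
    rw [shiftedAdj_mulVec_ind, sum_shiftedAdj_of_notMem (by simpa using ha)]
  have hind : ∑ a, ind K a = #K := by simp [ind]
  have s1 := h.sum_shiftedAdj_mulVec (ind K)
  rw [← sum_add_sum_compl K, sum_congr rfl hin, sum_congr rfl hout, hind] at s1
  have s2 := h.sum_shiftedAdj_mulVec_sq (ind K)
  rw [← sum_add_sum_compl K, sum_congr rfl fun a ha => congrArg (· ^ 2) (hin a ha),
    sum_congr rfl fun a ha => congrArg (· ^ 2) (hout a ha), hind, ind_form,
    sum_congr rfl fun a ha => hK.sum_shiftedAdj ha] at s2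
  simp only [sum_const, nsmul_eq_mul] at s1 s2
  have hc : ((#Kᶜ : ℕ) : ℤ) = 1911 - #K := by
    have := card_add_card_compl K
    rw [h.card] at this
    omega
  have t1 : ∑ a ∈ Kᶜ, n a ≤ 7 * (1911 - #K) := by
    rw [← hc, mul_comm, ← nsmul_eq_mul]
    exact sum_le_card_nsmul _ _ _ fun a ha => hn a (by simpa using ha)
  have t2 : ∑ a ∈ Kᶜ, n a ^ 2 ≤ 7 * ∑ a ∈ Kᶜ, n a := by
    rw [mul_sum]
    refine sum_le_sum fun a ha => ?_
    nlinarith [hn a (by simpa using ha), hn0 a]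
  have t3 : 0 ≤ ∑ a ∈ Kᶜ, n a ^ 2 := sum_nonneg fun a _ => sq_nonneg _
  have hm' : (33 : ℤ) ≤ #K := by exact_mod_cast hm
  generalize (#K : ℤ) = m at *
  generalize ∑ a ∈ Kᶜ, n a ^ 2 = q at *
  have hs1 : ∑ a ∈ Kᶜ, n a = m * (271 - m) := by linarith
  rw [hs1] at t1 t2
  have hub : m ≤ 108 := by nlinarith
  interval_cases m <;> omega

end IsSRGWith

namespace IsSRGWith

lemma sum_neighbors_card_eq (h : G.IsSRGWith 1911 270 105 27) {x u : V} (hxu : G.Adj x u) :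
    ∑ z ∈ G.neighborFinset x, (if G.Adj u z then (1 : ℤ) else 0) = 105 := by
  have h1 : {z ∈ G.neighborFinset x | G.Adj u z} = ({z | G.Adj x z ∧ G.Adj u z} : Finset V) := by
    ext z
    simp
  rw [sum_boole, h1, h.card_common_of_adj hxu]
  rfl

lemma sum_neighbors_common_le (h : G.IsSRGWith 1911 270 105 27) {x u v : V} (hxu : G.Adj x u)
    (hxv : G.Adj x v) (hne : u ≠ v) (huv : ¬ G.Adj u v) :
    ∑ z ∈ G.neighborFinset x, (if G.Adj u z then (1 : ℤ) else 0) * (if G.Adj v z then 1 else 0)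
      ≤ 26 := by
  have h1 : #{z ∈ G.neighborFinset x | G.Adj u z ∧ G.Adj v z} < 27 := by
    rw [← h.card_common_of_not_adj hne huv]
    refine card_lt_card ⟨fun z hz => by simp_all, fun hsub => ?_⟩
    have : x ∈ ({z | G.Adj u z ∧ G.Adj v z} : Finset V) := by simp [hxu.symm, hxv.symm]
    simpa using hsub this
  simp only [← ite_and, mul_ite, mul_one, mul_zero, sum_boole, and_comm (a := G.Adj v _)]
  omega

/-- A 4-claw `u, v, a, b` at `x` in which `u, v` have only 24 common neighbours adjacent to `x`
is extremal for the Bonferroni inequality. -/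
lemma claw_extremal (h : G.IsSRGWith 1911 270 105 27) {x u v a b : V}
    (hxu : G.Adj x u) (hxv : G.Adj x v) (hxa : G.Adj x a) (hxb : G.Adj x b)
    (huv' : u ≠ v) (hua' : u ≠ a) (hub' : u ≠ b) (hva' : v ≠ a) (hvb' : v ≠ b) (hab' : a ≠ b)
    (huv : ¬ G.Adj u v) (hua : ¬ G.Adj u a) (hub : ¬ G.Adj u b) (hva : ¬ G.Adj v a)
    (hvb : ¬ G.Adj v b) (hab : ¬ G.Adj a b)
    (hcard : #{z | G.Adj x z ∧ z ≠ u ∧ z ≠ v ∧ ¬ G.Adj u z ∧ ¬ G.Adj v z} = 82) :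
    (∀ z, G.Adj x z → ¬ G.Adj u z → ¬ G.Adj v z → z ≠ u → z ≠ v → z ≠ a → z ≠ b →
      G.Adj a z ∨ G.Adj b z) ∧
    #{z | (G.Adj x z ∧ z ≠ u ∧ z ≠ v ∧ ¬ G.Adj u z ∧ ¬ G.Adj v z) ∧ z ≠ a ∧ ¬ G.Adj a z} = 28 := by
  let ι : V → V → ℤ := fun s z => if G.Adj s z then 1 else 0
  let δ : V → V → ℤ := fun s z => if z = s then 1 else 0
  set D := G.neighborFinset x with hD
  have hDcard : (#D : ℤ) = 270 := by
    have := h.regular.degree_eq x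
    exact_mod_cast this
  have hδ : ∀ s, G.Adj x s → ∑ z ∈ D, δ s z = 1 := by
    intro s hs
    simp [δ, D, hs]
  have sU := h.sum_neighbors_card_eq hxu
  have sV := h.sum_neighbors_card_eq hxv
  have sA := h.sum_neighbors_card_eq hxa
  have sB := h.sum_neighbors_card_eq hxb
  have sUA := h.sum_neighbors_common_le hxu hxa hua' hua
  have sUB := h.sum_neighbors_common_le hxu hxb hub' hub
  have sVA := h.sum_neighbors_common_le hxv hxa hva' hva
  have sVB := h.sum_neighbors_common_le hxv hxb hvb' hvb
  have sAB := h.sum_neighbors_common_le hxa hxb hab' hab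
  have sUV : ∑ z ∈ D, ι u z * ι v z = 24 := by
    have h1 : ∑ z ∈ D, (1 - ι u z - ι v z + ι u z * ι v z - δ u z - δ v z) = 82 := by
      have hcard' := congrArg (Nat.cast : ℕ → ℤ) hcard
      rw [Nat.cast_ofNat] at hcard'
      rw [← hcard', card_filter, Nat.cast_sum, ← sum_filter_add_sum_filter_not
        univ (G.Adj x), ← add_zero (∑ z ∈ D, _)]
      congr 1
      · refine sum_congr (by ext; simp [D]) fun z hz => ?_
        have hz' : G.Adj x z := by simpa using hz
        by_cases h1 : z = u
        · subst h1; simp [ι, δ, huv', G.adj_comm v, huv]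
        by_cases h2 : z = v
        · subst h2; simp [ι, δ, huv'.symm, huv]
        by_cases h3 : G.Adj u z <;> by_cases h4 : G.Adj v z <;> simp [ι, δ, *]
      · refine (sum_eq_zero fun z hz => ?_).symm
        have hz' : ¬ G.Adj x z := by simpa using hz
        simp [hz']
    simp only [sum_add_distrib, sum_sub_distrib, hδ u hxu, hδ v hxv] at h1
    simp only [ι] at h1 ⊢
    rw [sU, sV] at h1
    simp only [sum_const, nsmul_eq_mul, mul_one, hDcard] at h1
    linarith
  let g : V → ℤ := fun z => 1 - ι u z - ι v z - ι a z - ι b z + ι u z * ι v z + ι u z * ι a z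
    + ι u z * ι b z + ι v z * ι a z + ι v z * ι b z + ι a z * ι b z
    - δ u z - δ v z - δ a z - δ b z
  have hg : ∀ z, 0 ≤ g z := by
    intro z
    by_cases h1 : z = u
    · subst h1; simp [g, ι, δ, *, G.adj_comm v, G.adj_comm a, G.adj_comm b]
    by_cases h2 : z = v
    · subst h2; simp [g, ι, δ, *, G.adj_comm a, G.adj_comm b]
    by_cases h3 : z = a
    · subst h3; simp [g, ι, δ, *, G.adj_comm b]
    by_cases h4 : z = b
    · subst h4; simp [g, ι, δ, *]
    by_cases h5 : G.Adj u z <;> by_cases h6 : G.Adj v z <;> by_cases h7 : G.Adj a z <;>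
      by_cases h8 : G.Adj b z <;> simp [g, ι, δ, *]
  have hsum : ∑ z ∈ D, g z = 270 - 420 + 24 + ∑ z ∈ D, ι u z * ι a z + ∑ z ∈ D, ι u z * ι b z
      + ∑ z ∈ D, ι v z * ι a z + ∑ z ∈ D, ι v z * ι b z + ∑ z ∈ D, ι a z * ι b z - 4 := by
    simp only [g, sum_add_distrib, sum_sub_distrib, hδ u hxu, hδ v hxv, hδ a hxa, hδ b hxb, sUV]
    simp only [ι]
    rw [sU, sV, sA, sB]
    simp only [sum_const, nsmul_eq_mul, mul_one, hDcard]
    ring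
  have hsum0 : 0 ≤ ∑ z ∈ D, g z := sum_nonneg fun z _ => hg z
  change ∑ z ∈ D, ι u z * ι a z ≤ 26 at sUA
  change ∑ z ∈ D, ι u z * ι b z ≤ 26 at sUB
  change ∑ z ∈ D, ι v z * ι a z ≤ 26 at sVA
  change ∑ z ∈ D, ι v z * ι b z ≤ 26 at sVB
  change ∑ z ∈ D, ι a z * ι b z ≤ 26 at sAB
  have hg0 : ∀ z ∈ D, g z = 0 := by
    rw [← sum_eq_zero_iff_of_nonneg fun z _ => hg z]
    linarith
  constructor
  · intro z hz h1 h2 h3 h4 h5 h6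
    have := hg0 z (by simpa [D] using hz)
    by_contra! hcon
    simp [g, ι, δ, *] at this
  · have hUVA : ∀ z ∈ D, ι u z * ι v z * ι a z = 0 := by
      intro z hz
      have h0 := hg0 z hz
      by_cases h1 : G.Adj u z
      · by_cases h2 : G.Adj v z
        · by_cases h3 : G.Adj a z
          · exfalso
            have e1 : z ≠ u := h1.ne'
            have e2 : z ≠ v := h2.ne'
            have e3 : z ≠ a := h3.ne'
            have e4 : z ≠ b := by rintro rfl; exact hab h3
            by_cases h4 : G.Adj b z <;> simp [g, ι, δ, *] at h0
          · simp [ι, h3]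
        · simp [ι, h2]
      · simp [ι, h1]
    have h1 : ∑ z ∈ D, (1 - ι u z - ι v z - ι a z + ι u z * ι v z + ι u z * ι a z + ι v z * ι a z
        - ι u z * ι v z * ι a z - δ u z - δ v z - δ a z) =
        #{z | (G.Adj x z ∧ z ≠ u ∧ z ≠ v ∧ ¬ G.Adj u z ∧ ¬ G.Adj v z) ∧ z ≠ a ∧ ¬ G.Adj a z} := by
      rw [card_filter, Nat.cast_sum, ← sum_filter_add_sum_filter_not
        univ (G.Adj x), ← add_zero (∑ z ∈ D, _)]
      congr 1
      · refine sum_congr (by ext; simp [D]) fun z hz => ?_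
        have hz' : G.Adj x z := by simpa using hz
        by_cases h1 : z = u
        · subst h1; simp [ι, δ, *, G.adj_comm v, G.adj_comm a]
        by_cases h2 : z = v
        · subst h2; simp [ι, δ, *, G.adj_comm a]
        by_cases h3 : z = a
        · subst h3; simp [ι, δ, *]
        by_cases h4 : G.Adj u z <;> by_cases h5 : G.Adj v z <;> by_cases h6 : G.Adj a z <;>
          simp [ι, δ, *]
      · refine (sum_eq_zero fun z hz => ?_).symm
        have hz' : ¬ G.Adj x z := by simpa using hz
        simp [hz']
    simp only [sum_add_distrib, sum_sub_distrib, hδ u hxu, hδ v hxv, hδ a hxa, sUV,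
      sum_eq_zero hUVA] at h1
    have sU' : ∑ z ∈ D, ι u z = 105 := sU
    have sV' : ∑ z ∈ D, ι v z = 105 := sV
    have sA' : ∑ z ∈ D, ι a z = 105 := sA
    rw [sU', sV', sA'] at h1
    simp only [sum_const, nsmul_eq_mul, mul_one, hDcard] at h1
    zify
    linarith

end IsSRGWith

end SRG

end SimpleGraph

/-- Let `G` be a strongly regular graph with parameters `(1911, 270, 105, 27)` with an
induced quadrangle `x ~ u ~ y ~ v ~ x`, and let
`W = {w : w ~ x, w ∉ {u,v}, w ≁ u, w ≁ v}`. Then `|W| ≠ 82`. -/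
theorem srg_1911_W_card_ne_82 {V : Type*} [Fintype V] [DecidableEq V]
    (G : SimpleGraph V) [DecidableRel G.Adj] (h : G.IsSRGWith 1911 270 105 27)
    (x u y v : V)
    (hd : x ≠ u ∧ x ≠ y ∧ x ≠ v ∧ u ≠ y ∧ u ≠ v ∧ y ≠ v)
    (hxu : G.Adj x u) (huy : G.Adj u y) (hyv : G.Adj y v) (hvx : G.Adj v x)
    (hxy : ¬ G.Adj x y) (huv : ¬ G.Adj u v)
    (W : Finset V)
    (hW : W = Finset.univ.filter fun w =>
      G.Adj x w ∧ w ≠ u ∧ w ≠ v ∧ ¬ G.Adj u w ∧ ¬ G.Adj v w) :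
    W.card ≠ 82 := by
  intro hcard
  have hmem : ∀ w, w ∈ W ↔ G.Adj x w ∧ w ≠ u ∧ w ≠ v ∧ ¬ G.Adj u w ∧ ¬ G.Adj v w := by
    intro w; simp [hW]
  have hcard' := hcard
  rw [hW] at hcard'
  have hxW : ∀ I ⊆ W, x ∉ I := fun I hI hx => G.loopless.irrefl x ((hmem x).1 (hI hx)).1
  have claw : ∀ a ∈ W, ∀ b ∈ W, Gᶜ.Adj a b → _ := fun a ha b hb hab =>
    have ha' := (hmem a).1 ha
    have hb' := (hmem b).1 hb
    h.claw_extremal hxu hvx.symm ha'.1 hb'.1 hd.2.2.2.2.1 ha'.2.1.symm hb'.2.1.symm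
      ha'.2.2.1.symm hb'.2.2.1.symm hab.1 huv ha'.2.2.2.1 hb'.2.2.2.1 ha'.2.2.2.2 hb'.2.2.2.2
      hab.2 hcard'
  have hclique : ∀ I ⊆ W, (∀ a ∈ I, ∀ b ∈ I, ¬ Gᶜ.Adj a b) →
      G.IsClique (insert x I : Finset V) := by
    intro I hI hind
    rw [coe_insert, SimpleGraph.isClique_insert]
    refine ⟨fun a ha b hb hab => ?_, fun b hb _ => ((hmem b).1 (hI hb)).1⟩
    by_contra hadj
    exact hind a ha b hb ((SimpleGraph.compl_adj ..).2 ⟨hab, hadj⟩)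
  refine SimpleGraph.false_of_triangle_free_of_card (H := Gᶜ) hcard ?_ ?_ ?_ ?_
  · intro a ha b hb c hc hab hbc hac
    have hc' := (hmem c).1 hc
    rcases (claw a ha b hb hab).1 c hc'.1 hc'.2.2.2.1 hc'.2.2.2.2 hc'.2.1 hc'.2.2.1 hac.1.symm
      hbc.1.symm with hadj | hadj
    · exact hac.2 hadj
    · exact hbc.2 hadj
  · intro a ha b hb hab
    rw [← (claw a ha b hb hab).2]
    congr 1
    ext z
    simp only [mem_filter, hmem, SimpleGraph.compl_adj, mem_univ, true_and, ne_comm (a := a)]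
  · intro I hI hind
    have := h.clique_card_le (hclique I hI hind)
    rw [card_insert_of_notMem (hxW I hI)] at this
    omega
  · intro I hI hind hI28 a ha haI
    have hax : G.Adj x a := ((hmem a).1 ha).1
    have hK : a ∉ insert x I := by simp [haI, hax.ne']
    have hbound := h.clique_neighbors_bound (hclique I hI hind) hK rfl
    rw [filter_insert, if_pos hax.symm, card_insert_of_notMem
      (fun hx => hxW I hI (mem_filter.1 hx).1), card_insert_of_notMem (hxW I hI), hI28] at hbound
    have hsplit : #{b ∈ I | G.Adj a b} + #{b ∈ I | ¬ G.Adj a b} = 28 :=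
      (card_filter_add_card_filter_not _).trans hI28
    have hcompl : #{b ∈ I | ¬ G.Adj a b} = #{b ∈ I | Gᶜ.Adj a b} := by
      congr 1
      refine filter_congr fun b hb => ?_
      have : a ≠ b := by rintro rfl; exact haI hb
      simp [SimpleGraph.compl_adj, this]
    rw [← hcompl]
    by_contra! hcon
    obtain ⟨h7, h20⟩ := hcon
    push_cast at hbound
    have e : (#{b ∈ I | G.Adj a b} : ℤ) = 28 - #{b ∈ I | ¬ G.Adj a b} := by omega
    rw [e] at hbound
    have h7' : (7 : ℤ) ≤ #{b ∈ I | ¬ G.Adj a b} := by omega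
    have h20' : (#{b ∈ I | ¬ G.Adj a b} : ℤ) ≤ 20 := by omega
    nlinarith
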